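/- arXiv:2405.02081 — 2 statements merged into one kernel-verified Lean document; each statement's English description precedes it below -/
import Mathlib

section
/- Label-dependent lower bound for local SimCLR (semi-supervised, discrete version): Let S and Y be random variables on finite types with joint pmf p(s, y), and for each pair (s, y) let p(z1, z2 | y, s) be a joint pmf of (Z1, Z2) on a finite type Z × Z. Let f : Z × Z → ℝ be a critic function, K ≥ 1 a natural number, and r(y | z) a conditional probability mass function over the values of Y with r(y | z) > 0 whenever P(Y=y, Z1=z) > 0 or P(Y=y, Z2=z) > 0. Then I(Z1; Z2 | S) ≥ ∑_{s,y} p(s, y) · ( E[ (1/K) ∑_{k=1}^{K} ( log( exp(f(z1_k, z2_k)) / ( (1/K) ∑_{j=1}^{K} exp(f(z1_j, z2_k)) ) ) + log r(y | z1_k) + log r(y | z2_k) ) ] + H(Y | S=s) ), where the expectation is over K pairs (z1_k, z2_k) drawn i.i.d. from p(z1, z2 | y, s), and H(Y | S=s) := −∑_y P(Y=y | S=s) · log P(Y=y | S=s). -/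
/-!
Label-dependent lower bound for local SimCLR (semi-supervised, discrete
version): with `(S, Y) ~ pSY` and `(Z1, Z2) | (Y = y, S = s) ~ pC s y`
(joint pmf `p s y z1 z2 = pSY s y * pC s y z1 z2`), for any critic `f`,
any `K ≥ 1` and any label classifier `r (y | z)` positive on the support of
the joint marginals with either view,
I(Z1; Z2 | S) ≥ ∑_{s,y} p(s,y) · ( E[ (1/K) ∑_k ( InfoNCE term
  + log r(y|z1_k) + log r(y|z2_k) ) ] + H(Y | S = s) ).
-/

open Finset

noncomputable section

variable {S Y Z : Type*} [Fintype S] [Fintype Y] [Fintype Z]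

/-- The joint pmf of (S, Y, Z1, Z2). -/
def joint (pSY : S → Y → ℝ) (pC : S → Y → Z → Z → ℝ) (s : S) (y : Y) (z1 z2 : Z) : ℝ :=
  pSY s y * pC s y z1 z2

/-- Marginal P(S = s). -/
def margS (p : S → Y → Z → Z → ℝ) (s : S) : ℝ := ∑ y, ∑ z1, ∑ z2, p s y z1 z2

/-- Marginal P(S = s, Z1 = z1). -/
def margSZ1 (p : S → Y → Z → Z → ℝ) (s : S) (z1 : Z) : ℝ := ∑ y, ∑ z2, p s y z1 z2

/-- Marginal P(S = s, Z2 = z2). -/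
def margSZ2 (p : S → Y → Z → Z → ℝ) (s : S) (z2 : Z) : ℝ := ∑ y, ∑ z1, p s y z1 z2

/-- Marginal P(S = s, Z1 = z1, Z2 = z2). -/
def margSZ1Z2 (p : S → Y → Z → Z → ℝ) (s : S) (z1 z2 : Z) : ℝ := ∑ y, p s y z1 z2

/-- Marginal P(Y = y, Z1 = z1). -/
def margYZ1 (p : S → Y → Z → Z → ℝ) (y : Y) (z1 : Z) : ℝ := ∑ s, ∑ z2, p s y z1 z2

/-- Marginal P(Y = y, Z2 = z2). -/
def margYZ2 (p : S → Y → Z → Z → ℝ) (y : Y) (z2 : Z) : ℝ := ∑ s, ∑ z1, p s y z1 z2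

/-- Conditional mutual information I(Z1; Z2 | S), with terms of zero joint
probability contributing 0. -/
def cmiZ1Z2_S (p : S → Y → Z → Z → ℝ) : ℝ :=
  ∑ s, ∑ z1, ∑ z2, margSZ1Z2 p s z1 z2 *
    Real.log ((margSZ1Z2 p s z1 z2 / margS p s) /
      ((margSZ1 p s z1 / margS p s) * (margSZ2 p s z2 / margS p s)))

/-- Conditional entropy H(Y | S = s) computed from the pmf of (S, Y). -/
def entY_at (pSY : S → Y → ℝ) (s : S) : ℝ :=
  -∑ y, (pSY s y / ∑ y', pSY s y') * Real.log (pSY s y / ∑ y', pSY s y')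

/-- Mutual information of a joint pmf on `Z × Z`. -/
def mutualInfo (p : Z → Z → ℝ) : ℝ :=
  ∑ x, ∑ y, p x y * Real.log (p x y / ((∑ y', p x y') * ∑ x', p x' y))

/-- The InfoNCE ratio at index `k`, for first views `a` and second view `b`. -/
def nceRatio {K : ℕ} (f : Z → Z → ℝ) (k : Fin K) (a : Fin K → Z) (b : Z) : ℝ :=
  Real.exp (f (a k) b) / ((1 / (K : ℝ)) * ∑ j : Fin K, Real.exp (f (a j) b))

theorem sum_prod_erase_mul {ι α : Type*} [Fintype ι] [DecidableEq ι] [Fintype α]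
    (k : ι) (h : ι → α → ℝ) (g : α → ℝ) :
    ∑ b : ι → α, (∏ i ∈ univ.erase k, h i (b i)) * g (b k) =
      (∏ i ∈ univ.erase k, ∑ z, h i z) * ∑ z, g z := by
  have key := Fintype.prod_sum (Function.update h k g)
  rw [← Finset.prod_erase_mul _ _ (mem_univ k)] at key
  rw [Function.update_self, Finset.prod_congr rfl (g := fun i => ∑ z, h i z)
    (fun i hi => by rw [Function.update_of_ne (ne_of_mem_erase hi)])] at key
  rw [key]
  refine Finset.sum_congr rfl fun b _ => ?_
  rw [← Finset.prod_erase_mul _ _ (mem_univ k), Function.update_self]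
  congr 1
  exact Finset.prod_congr rfl fun i hi => by rw [Function.update_of_ne (ne_of_mem_erase hi)]

theorem sum_prod_mul_apply {ι α : Type*} [Fintype ι] [DecidableEq ι] [Fintype α]
    (k : ι) (p : α → ℝ) (hp : ∑ z, p z = 1) (g : α → ℝ) :
    ∑ b : ι → α, (∏ i, p (b i)) * g (b k) = ∑ z, p z * g z := by
  have key := sum_prod_erase_mul k (fun _ => p) (fun z => p z * g z)
  simp only [hp, Finset.prod_const_one, one_mul] at key
  rw [← key]
  refine Finset.sum_congr rfl fun b _ => ?_
  rw [← Finset.prod_erase_mul _ _ (mem_univ k), mul_assoc]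

theorem nceRatio_pos {α : Type*} {K : ℕ} (f : α → α → ℝ) (k : Fin K) (a : Fin K → α) (b : α) :
    0 < nceRatio f k a b := by
  have hK : 0 < (K : ℝ) := by exact_mod_cast k.pos
  have hs : 0 < ∑ j : Fin K, Real.exp (f (a j) b) :=
    Finset.sum_pos (fun j _ => Real.exp_pos _) ⟨k, mem_univ k⟩
  unfold nceRatio
  positivity

theorem sum_nceRatio {α : Type*} {K : ℕ} (hK : 1 ≤ K) (f : α → α → ℝ) (a : Fin K → α) (b : α) :
    ∑ k, nceRatio f k a b = K := by
  have hK0 : 0 < (K : ℝ) := by exact_mod_cast hK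
  have hs : 0 < ∑ j : Fin K, Real.exp (f (a j) b) :=
    Finset.sum_pos (fun j _ => Real.exp_pos _) ⟨⟨0, hK⟩, mem_univ _⟩
  unfold nceRatio
  rw [← Finset.sum_div]
  field_simp

/-- Change of measure: decoupling the second view of the `k`-th pair from its first view. -/
theorem sum_decoupled_nceRatio {K : ℕ} (f : Z → Z → ℝ) (p : Z → Z → ℝ) (k : Fin K) :
    ∑ v : Fin K → Z × Z, (∏ i ∈ univ.erase k, p (v i).1 (v i).2) *
        (((∑ y, p (v k).1 y) * ∑ x, p x (v k).2) *
          nceRatio f k (fun j => (v j).1) (v k).2) =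
      ∑ a : Fin K → Z, (∏ i, ∑ y, p (a i) y) *
        ∑ z, (∑ x, p x z) * nceRatio f k a z := by
  rw [← (Equiv.arrowProdEquivProdArrow (Fin K) (fun _ => Z) (fun _ => Z)).symm.sum_comp,
    Fintype.sum_prod_type]
  refine Finset.sum_congr rfl fun a _ => ?_
  have key := sum_prod_erase_mul k (fun i => p (a i))
    (fun z => ((∑ y, p (a k) y) * ∑ x, p x z) * nceRatio f k a z)
  refine Eq.trans key ?_
  rw [← Finset.prod_erase_mul _ _ (mem_univ k), mul_assoc]
  congr 1
  rw [Finset.mul_sum]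
  exact Finset.sum_congr rfl fun z _ => by ring

theorem log_nceRatio_le {K : ℕ} (f : Z → Z → ℝ) (p : Z → Z → ℝ)
    (hp : ∀ x y, 0 ≤ p x y) (k : Fin K) (v : Fin K → Z × Z) :
    (∏ i, p (v i).1 (v i).2) * Real.log (nceRatio f k (fun j => (v j).1) (v k).2) ≤
      (∏ i, p (v i).1 (v i).2) * (Real.log (p (v k).1 (v k).2 /
          ((∑ y, p (v k).1 y) * ∑ x, p x (v k).2)) - 1) +
      (∏ i ∈ univ.erase k, p (v i).1 (v i).2) *
        (((∑ y, p (v k).1 y) * ∑ x, p x (v k).2) *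
          nceRatio f k (fun j => (v j).1) (v k).2) := by
  have hN := nceRatio_pos f k (fun j => (v j).1) (v k).2
  set N := nceRatio f k (fun j => (v j).1) (v k).2
  rw [← Finset.prod_erase_mul _ _ (mem_univ k)]
  have hQ : 0 ≤ ∏ i ∈ univ.erase k, p (v i).1 (v i).2 := Finset.prod_nonneg fun i _ => hp _ _
  set Q := ∏ i ∈ univ.erase k, p (v i).1 (v i).2
  have h1 : p (v k).1 (v k).2 ≤ ∑ y, p (v k).1 y :=
    Finset.single_le_sum (f := fun y => p (v k).1 y) (fun y _ => hp _ y) (mem_univ _)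
  have h2 : p (v k).1 (v k).2 ≤ ∑ x, p x (v k).2 :=
    Finset.single_le_sum (f := fun x => p x (v k).2) (fun x _ => hp x _) (mem_univ _)
  have h0 := hp (v k).1 (v k).2
  set w := p (v k).1 (v k).2
  set A := ∑ y, p (v k).1 y
  set B := ∑ x, p x (v k).2
  rw [mul_assoc, mul_assoc, ← mul_add]
  refine mul_le_mul_of_nonneg_left ?_ hQ
  rcases h0.eq_or_lt with h | h
  · rw [← h] at h1 h2 ⊢
    simp only [zero_mul, zero_add]
    positivity
  · have hA : 0 < A := h.trans_le h1
    have hB : 0 < B := h.trans_le h2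
    have hlog := Real.log_le_sub_one_of_pos (show 0 < A * B / w * N by positivity)
    have hsplit : Real.log (A * B / w * N) = Real.log N - Real.log (w / (A * B)) := by
      rw [Real.log_mul (by positivity) hN.ne', ← inv_div w (A * B), Real.log_inv]
      ring
    rw [hsplit] at hlog
    have := mul_le_mul_of_nonneg_left hlog h0
    have e : w * (A * B / w * N - 1) = A * B * N - w := by field_simp
    linarith

/-- The InfoNCE lower bound on mutual information. -/
theorem infoNCE_le_mutualInfo {K : ℕ} (hK : 1 ≤ K) (f : Z → Z → ℝ) (p : Z → Z → ℝ)
    (hp : ∀ x y, 0 ≤ p x y) (hp1 : ∑ x, ∑ y, p x y = 1) :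
    ∑ v : Fin K → Z × Z, (∏ i, p (v i).1 (v i).2) *
      ((1 / (K : ℝ)) * ∑ k, Real.log (nceRatio f k (fun j => (v j).1) (v k).2)) ≤
      mutualInfo p := by
  have hK0 : 0 < (K : ℝ) := by exact_mod_cast hK
  have hp1' : ∑ z : Z × Z, p z.1 z.2 = 1 := by rw [Fintype.sum_prod_type, hp1]
  have hk : ∀ k : Fin K, ∑ v : Fin K → Z × Z, (∏ i, p (v i).1 (v i).2) *
      Real.log (nceRatio f k (fun j => (v j).1) (v k).2) ≤
      (mutualInfo p - 1) + ∑ a : Fin K → Z, (∏ i, ∑ y, p (a i) y) *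
        ∑ z, (∑ x, p x z) * nceRatio f k a z := by
    intro k
    refine (Finset.sum_le_sum fun v _ => log_nceRatio_le f p hp k v).trans_eq ?_
    rw [Finset.sum_add_distrib, sum_decoupled_nceRatio]
    congr 1
    have := sum_prod_mul_apply k (fun z : Z × Z => p z.1 z.2) hp1'
      (fun z => Real.log (p z.1 z.2 / ((∑ y, p z.1 y) * ∑ x, p x z.2)) - 1)
    rw [this]
    simp only [mul_sub, mul_one, Finset.sum_sub_distrib, hp1']
    rw [Fintype.sum_prod_type]
    rfl
  have hT : ∑ k : Fin K, ∑ a : Fin K → Z, (∏ i, ∑ y, p (a i) y) *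
        ∑ z, (∑ x, p x z) * nceRatio f k a z = K := by
    rw [Finset.sum_comm]
    have : ∀ a : Fin K → Z, ∑ k, (∏ i, ∑ y, p (a i) y) *
        ∑ z, (∑ x, p x z) * nceRatio f k a z = (∏ i, ∑ y, p (a i) y) * K := by
      intro a
      rw [← Finset.mul_sum, Finset.sum_comm]
      simp only [← Finset.mul_sum, sum_nceRatio hK]
      rw [← Finset.sum_mul, Finset.sum_comm, hp1, one_mul]
    simp only [this]
    rw [← Finset.sum_mul, ← Fintype.prod_sum (fun (_ : Fin K) x => ∑ y, p x y)]
    simp [hp1]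
  have hsum := Finset.sum_le_sum fun k (_ : k ∈ (univ : Finset (Fin K))) => hk k
  rw [Finset.sum_add_distrib, hT, Finset.sum_comm] at hsum
  simp only [Finset.sum_const, Finset.card_univ, Fintype.card_fin, nsmul_eq_mul,
    ← Finset.mul_sum] at hsum
  have e : ∑ v : Fin K → Z × Z, (∏ i, p (v i).1 (v i).2) *
      ((1 / (K : ℝ)) * ∑ k, Real.log (nceRatio f k (fun j => (v j).1) (v k).2)) =
      (∑ v : Fin K → Z × Z, (∏ i, p (v i).1 (v i).2) *
        ∑ k, Real.log (nceRatio f k (fun j => (v j).1) (v k).2)) / K := by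
    rw [Finset.sum_div]
    exact Finset.sum_congr rfl fun v _ => by ring
  rw [e, div_le_iff₀ hK0]
  linarith

/-- Splitting the i.i.d. expectation into the InfoNCE term and the classifier terms. -/
theorem expectation_simclr_le {K : ℕ} (hK : 1 ≤ K) (f : Z → Z → ℝ) (p : Z → Z → ℝ)
    (hp : ∀ x y, 0 ≤ p x y) (hp1 : ∑ x, ∑ y, p x y = 1) (g₁ g₂ : Z → ℝ) :
    ∑ v : Fin K → Z × Z, (∏ k, p (v k).1 (v k).2) *
      ((1 / (K : ℝ)) * ∑ k : Fin K,
        (Real.log (Real.exp (f (v k).1 (v k).2) /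
            ((1 / (K : ℝ)) * ∑ j : Fin K, Real.exp (f (v j).1 (v k).2)))
          + g₁ (v k).1 + g₂ (v k).2)) ≤
      mutualInfo p + ∑ x, ∑ y, p x y * (g₁ x + g₂ y) := by
  have hK0 : 0 < (K : ℝ) := by exact_mod_cast hK
  have hp1' : ∑ z : Z × Z, p z.1 z.2 = 1 := by rw [Fintype.sum_prod_type, hp1]
  have hg : ∑ v : Fin K → Z × Z, (∏ k, p (v k).1 (v k).2) *
      ((1 / (K : ℝ)) * ∑ k : Fin K, (g₁ (v k).1 + g₂ (v k).2)) =
      ∑ x, ∑ y, p x y * (g₁ x + g₂ y) := by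
    have h (k : Fin K) := sum_prod_mul_apply k (fun z : Z × Z => p z.1 z.2) hp1'
      (fun z => g₁ z.1 + g₂ z.2)
    simp only [Finset.mul_sum]
    rw [Finset.sum_comm]
    simp only [mul_left_comm _ (1 / (K : ℝ)), ← Finset.mul_sum, h]
    rw [Fintype.sum_prod_type]
    simp
    field_simp
  rw [← hg]
  refine le_trans (le_of_eq ?_) (add_le_add_left (infoNCE_le_mutualInfo hK f p hp hp1) _)
  rw [← Finset.sum_add_distrib]
  refine Finset.sum_congr rfl fun v _ => ?_
  rw [← mul_add, ← mul_add, ← Finset.sum_add_distrib]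
  simp only [nceRatio, add_assoc]

theorem gibbs_term_nonneg {α : Type*} [Fintype α] (a m : α → Y → ℝ) (r : α → Y → ℝ)
    (ha : ∀ z y, 0 ≤ a z y) (hr : ∀ z y, 0 ≤ r z y) (hr1 : ∀ z, ∑ y, r z y = 1)
    (hm : ∀ z y, m z y = ∑ y', a z y') :
    0 ≤ ∑ z, ∑ y, a z y * (1 - m z y * r z y / a z y) := by
  refine Finset.sum_nonneg fun z _ => ?_
  have h : ∀ y, a z y - (∑ y', a z y') * r z y ≤ a z y * (1 - m z y * r z y / a z y) := by
    intro y
    rw [hm]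
    have hs : 0 ≤ ∑ y', a z y' := Finset.sum_nonneg fun y' _ => ha z y'
    rcases (ha z y).eq_or_lt with h0 | h0
    · rw [← h0]
      have := mul_nonneg hs (hr z y)
      linarith
    · apply le_of_eq
      field_simp
  refine le_trans (le_of_eq ?_) (Finset.sum_le_sum fun y _ => h y)
  rw [Finset.sum_sub_distrib, ← Finset.mul_sum, hr1, mul_one, sub_self]

/-- Logarithmic form of the chain-rule estimate at a single point. -/
theorem log_chain_le {q m m12 m1 m2 c c1 c2 r1 r2 : ℝ} (hq : 0 < q) (hc : 0 < c)
    (hm : 0 < m) (hm1 : 0 < m1) (hm2 : 0 < m2) (hc1 : 0 < c1) (hc2 : 0 < c2)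
    (hr1 : 0 < r1) (hr2 : 0 < r2) (hle : q * c ≤ m12) :
    Real.log (c / (c1 * c2)) + Real.log r1 + Real.log r2 - Real.log (q / m) +
        (1 - m1 * r1 / (q * c1)) + (1 - m2 * r2 / (q * c2)) ≤
      Real.log ((m12 / m) / ((m1 / m) * (m2 / m))) := by
  have hm12 : 0 < m12 := (mul_pos hq hc).trans_le hle
  have h1 := Real.log_le_sub_one_of_pos (show 0 < m1 * r1 / (q * c1) by positivity)
  have h2 := Real.log_le_sub_one_of_pos (show 0 < m2 * r2 / (q * c2) by positivity)
  have h3 := Real.log_le_log (mul_pos hq hc) hle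
  rw [Real.log_div (by positivity) (by positivity), Real.log_mul (by positivity) (by positivity),
    Real.log_mul (by positivity) (by positivity)] at h1 h2
  rw [Real.log_mul (by positivity) (by positivity)] at h3
  rw [Real.log_div hc.ne' (by positivity), Real.log_mul hc1.ne' hc2.ne',
    Real.log_div hq.ne' hm.ne', Real.log_div (by positivity) (by positivity),
    Real.log_mul (by positivity) (by positivity), Real.log_div hm12.ne' hm.ne',
    Real.log_div hm1.ne' hm.ne', Real.log_div hm2.ne' hm.ne']
  linarith

theorem sum_mul_entY_at {α : Type*} (pSY : α → Y → ℝ) (h : ∀ s y, 0 ≤ pSY s y) (s : α) :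
    ∑ y, pSY s y * entY_at pSY s =
      -∑ y, pSY s y * Real.log (pSY s y / ∑ y', pSY s y') := by
  rw [← Finset.sum_mul, entY_at, mul_neg, Finset.mul_sum]
  congr 1
  refine Finset.sum_congr rfl fun y _ => ?_
  rcases (Finset.sum_nonneg fun y (_ : y ∈ univ) => h s y).eq_or_lt with h0 | h0
  · have : pSY s y = 0 :=
      (Finset.sum_eq_zero_iff_of_nonneg fun y _ => h s y).1 h0.symm y (mem_univ y)
    simp [this]
  · field_simp

theorem sum_sum_pos_of_pos {α β : Type*} [Fintype α] [Fintype β] (g : α → β → ℝ)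
    (hg : ∀ i j, 0 ≤ g i j) (i : α) (j : β) (hij : 0 < g i j) : 0 < ∑ i, ∑ j, g i j :=
  Finset.sum_pos' (fun i _ => Finset.sum_nonneg fun j _ => hg i j)
    ⟨i, mem_univ i, Finset.sum_pos' (fun j _ => hg i j) ⟨j, mem_univ j, hij⟩⟩

/-- The single-point estimate for `joint pSY pC`, weighted by the joint pmf. -/
theorem joint_mul_log_chain_le (pSY : S → Y → ℝ) (pC : S → Y → Z → Z → ℝ)
    (hpSY_nonneg : ∀ s y, 0 ≤ pSY s y)
    (hpC_nonneg : ∀ s y z1 z2, 0 ≤ pC s y z1 z2)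
    (hpC_sum : ∀ s y, ∑ z1, ∑ z2, pC s y z1 z2 = 1)
    (r : Z → Y → ℝ)
    (hr_pos : ∀ y z,
      0 < margYZ1 (joint pSY pC) y z ∨ 0 < margYZ2 (joint pSY pC) y z →
      0 < r z y) (s : S) (y : Y) (z1 z2 : Z) :
    joint pSY pC s y z1 z2 *
      (Real.log (pC s y z1 z2 / ((∑ z, pC s y z1 z) * ∑ z, pC s y z z2)) +
        Real.log (r z1 y) + Real.log (r z2 y) - Real.log (pSY s y / ∑ y', pSY s y') +
        (1 - margSZ1 (joint pSY pC) s z1 * r z1 y / (pSY s y * ∑ z, pC s y z1 z)) +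
        (1 - margSZ2 (joint pSY pC) s z2 * r z2 y / (pSY s y * ∑ z, pC s y z z2))) ≤
      joint pSY pC s y z1 z2 * Real.log ((margSZ1Z2 (joint pSY pC) s z1 z2 /
        margS (joint pSY pC) s) / ((margSZ1 (joint pSY pC) s z1 / margS (joint pSY pC) s) *
          (margSZ2 (joint pSY pC) s z2 / margS (joint pSY pC) s))) := by
  have hJ : ∀ s y z1 z2, 0 ≤ joint pSY pC s y z1 z2 := fun s y z1 z2 =>
    mul_nonneg (hpSY_nonneg s y) (hpC_nonneg s y z1 z2)
  rcases (hJ s y z1 z2).eq_or_lt with h | h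
  · simp [← h]
  have hq : 0 < pSY s y := (hpSY_nonneg s y).lt_of_ne fun e => by simp [joint, ← e] at h
  have hc : 0 < pC s y z1 z2 :=
    (hpC_nonneg s y z1 z2).lt_of_ne fun e => by simp [joint, ← e] at h
  have hm : margS (joint pSY pC) s = ∑ y', pSY s y' := by
    simp [margS, joint, ← Finset.mul_sum, hpC_sum]
  have hr1 : 0 < r z1 y := hr_pos y z1 <| Or.inl <|
    sum_sum_pos_of_pos _ (fun s z => hJ s y z1 z) s z2 h
  have hr2 : 0 < r z2 y := hr_pos y z2 <| Or.inr <|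
    sum_sum_pos_of_pos _ (fun s z => hJ s y z z2) s z1 h
  refine mul_le_mul_of_nonneg_left ?_ h.le
  rw [hm]
  refine log_chain_le hq hc ?_ ?_ ?_ ?_ ?_ hr1 hr2 ?_
  · exact Finset.sum_pos' (fun y _ => hpSY_nonneg s y) ⟨y, mem_univ y, hq⟩
  · exact sum_sum_pos_of_pos _ (fun y z => hJ s y z1 z) y z2 h
  · exact sum_sum_pos_of_pos _ (fun y z => hJ s y z z2) y z1 h
  · exact Finset.sum_pos' (fun z _ => hpC_nonneg s y z1 z) ⟨z2, mem_univ z2, hc⟩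
  · exact Finset.sum_pos' (fun z _ => hpC_nonneg s y z z2) ⟨z1, mem_univ z1, hc⟩
  · exact Finset.single_le_sum (f := fun y => joint pSY pC s y z1 z2)
      (fun y _ => hJ s y z1 z2) (mem_univ y)

/-- Label-dependent lower bound for local SimCLR. -/
theorem label_dependent_local_simclr_bound
    (pSY : S → Y → ℝ) (pC : S → Y → Z → Z → ℝ)
    (hpSY_nonneg : ∀ s y, 0 ≤ pSY s y) (hpSY_sum : ∑ s, ∑ y, pSY s y = 1)
    (hpC_nonneg : ∀ s y z1 z2, 0 ≤ pC s y z1 z2)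
    (hpC_sum : ∀ s y, ∑ z1, ∑ z2, pC s y z1 z2 = 1)
    (K : ℕ) (hK : 1 ≤ K) (f : Z → Z → ℝ)
    (r : Z → Y → ℝ)
    (hr_nonneg : ∀ z y, 0 ≤ r z y)
    (hr_sum : ∀ z, ∑ y, r z y = 1)
    (hr_pos : ∀ y z,
      0 < margYZ1 (joint pSY pC) y z ∨ 0 < margYZ2 (joint pSY pC) y z →
      0 < r z y) :
    cmiZ1Z2_S (joint pSY pC) ≥
      ∑ s, ∑ y, pSY s y *
        ((∑ v : Fin K → Z × Z, (∏ k, pC s y (v k).1 (v k).2) *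
          ((1 / (K : ℝ)) * ∑ k : Fin K,
            (Real.log (Real.exp (f (v k).1 (v k).2) /
                ((1 / (K : ℝ)) * ∑ j : Fin K, Real.exp (f (v j).1 (v k).2)))
              + Real.log (r (v k).1 y) + Real.log (r (v k).2 y)))) +
          entY_at pSY s) := by
  refine Finset.sum_le_sum fun s _ => ?_
  have hJ : ∀ s y z1 z2, 0 ≤ joint pSY pC s y z1 z2 := fun s y z1 z2 =>
    mul_nonneg (hpSY_nonneg s y) (hpC_nonneg s y z1 z2)
  simp only [mul_add, Finset.sum_add_distrib, sum_mul_entY_at pSY hpSY_nonneg]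
  have hE := Finset.sum_le_sum fun y (_ : y ∈ (univ : Finset Y)) =>
    mul_le_mul_of_nonneg_left (expectation_simclr_le hK f (pC s y) (hpC_nonneg s y) (hpC_sum s y)
      (fun z => Real.log (r z y)) (fun z => Real.log (r z y))) (hpSY_nonneg s y)
  have hpt := Finset.sum_le_sum fun z1 (_ : z1 ∈ (univ : Finset Z)) =>
    Finset.sum_le_sum fun z2 (_ : z2 ∈ (univ : Finset Z)) =>
    Finset.sum_le_sum fun y (_ : y ∈ (univ : Finset Y)) =>
      joint_mul_log_chain_le pSY pC hpSY_nonneg hpC_nonneg hpC_sum r hr_pos s y z1 z2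
  have hG1 : 0 ≤ ∑ z1, ∑ z2, ∑ y, joint pSY pC s y z1 z2 *
      (1 - margSZ1 (joint pSY pC) s z1 * r z1 y / (pSY s y * ∑ z, pC s y z1 z)) := by
    have h := gibbs_term_nonneg (fun z1 y => pSY s y * ∑ z, pC s y z1 z)
      (fun z1 _ => margSZ1 (joint pSY pC) s z1) r
      (fun z y => mul_nonneg (hpSY_nonneg s y) (Finset.sum_nonneg fun _ _ => hpC_nonneg _ _ _ _))
      hr_nonneg hr_sum (fun z y => by simp only [margSZ1, joint, Finset.mul_sum])
    refine h.trans_eq (Finset.sum_congr rfl fun z1 _ => ?_)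
    rw [Finset.sum_comm]
    refine Finset.sum_congr rfl fun y _ => ?_
    rw [← Finset.sum_mul]
    simp only [joint, ← Finset.mul_sum]
  have hG2 : 0 ≤ ∑ z1, ∑ z2, ∑ y, joint pSY pC s y z1 z2 *
      (1 - margSZ2 (joint pSY pC) s z2 * r z2 y / (pSY s y * ∑ z, pC s y z z2)) := by
    have h := gibbs_term_nonneg (fun z2 y => pSY s y * ∑ z, pC s y z z2)
      (fun z2 _ => margSZ2 (joint pSY pC) s z2) r
      (fun z y => mul_nonneg (hpSY_nonneg s y) (Finset.sum_nonneg fun _ _ => hpC_nonneg _ _ _ _))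
      hr_nonneg hr_sum (fun z y => by simp only [margSZ2, joint, Finset.mul_sum])
    rw [Finset.sum_comm]
    refine h.trans_eq (Finset.sum_congr rfl fun z2 _ => ?_)
    rw [Finset.sum_comm]
    refine Finset.sum_congr rfl fun y _ => ?_
    rw [← Finset.sum_mul]
    simp only [joint, ← Finset.mul_sum]
  have hM : ∑ z1, ∑ z2, ∑ y, joint pSY pC s y z1 z2 *
      (Real.log (pC s y z1 z2 / ((∑ z, pC s y z1 z) * ∑ z, pC s y z z2)) +
        Real.log (r z1 y) + Real.log (r z2 y) - Real.log (pSY s y / ∑ y', pSY s y')) =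
      ∑ y, pSY s y * (mutualInfo (pC s y) +
        ∑ z1, ∑ z2, pC s y z1 z2 * (Real.log (r z1 y) + Real.log (r z2 y))) -
      ∑ y, pSY s y * Real.log (pSY s y / ∑ y', pSY s y') := by
    have hswap (g : Z → Z → Y → ℝ) : ∑ z1, ∑ z2, ∑ y, g z1 z2 y = ∑ y, ∑ z1, ∑ z2, g z1 z2 y := by
      rw [Finset.sum_comm]
      conv_rhs => rw [Finset.sum_comm]
      rw [Finset.sum_comm]
      exact Finset.sum_congr rfl fun z1 _ => Finset.sum_comm
    rw [hswap, ← Finset.sum_sub_distrib]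
    refine Finset.sum_congr rfl fun y _ => ?_
    have hH : pSY s y * Real.log (pSY s y / ∑ y', pSY s y') =
        pSY s y * ∑ z1, ∑ z2, pC s y z1 z2 * Real.log (pSY s y / ∑ y', pSY s y') := by
      simp only [← Finset.sum_mul, hpC_sum, one_mul]
    rw [hH, mutualInfo, ← mul_sub]
    simp only [← Finset.sum_add_distrib, ← Finset.sum_sub_distrib, Finset.mul_sum]
    refine Finset.sum_congr rfl fun z1 _ => Finset.sum_congr rfl fun z2 _ => ?_
    simp only [joint]
    ring
  have hL : ∑ z1, ∑ z2, margSZ1Z2 (joint pSY pC) s z1 z2 *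
      Real.log ((margSZ1Z2 (joint pSY pC) s z1 z2 / margS (joint pSY pC) s) /
        ((margSZ1 (joint pSY pC) s z1 / margS (joint pSY pC) s) *
          (margSZ2 (joint pSY pC) s z2 / margS (joint pSY pC) s))) =
      ∑ z1, ∑ z2, ∑ y, joint pSY pC s y z1 z2 *
      Real.log ((margSZ1Z2 (joint pSY pC) s z1 z2 / margS (joint pSY pC) s) /
        ((margSZ1 (joint pSY pC) s z1 / margS (joint pSY pC) s) *
          (margSZ2 (joint pSY pC) s z2 / margS (joint pSY pC) s))) :=
    Finset.sum_congr rfl fun z1 _ => Finset.sum_congr rfl fun z2 _ => Finset.sum_mul _ _ _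
  have hsplit : ∑ z1, ∑ z2, ∑ y, joint pSY pC s y z1 z2 *
      (Real.log (pC s y z1 z2 / ((∑ z, pC s y z1 z) * ∑ z, pC s y z z2)) +
        Real.log (r z1 y) + Real.log (r z2 y) - Real.log (pSY s y / ∑ y', pSY s y') +
        (1 - margSZ1 (joint pSY pC) s z1 * r z1 y / (pSY s y * ∑ z, pC s y z1 z)) +
        (1 - margSZ2 (joint pSY pC) s z2 * r z2 y / (pSY s y * ∑ z, pC s y z z2))) = _ :=
    (Finset.sum_congr rfl fun z1 _ => Finset.sum_congr rfl fun z2 _ =>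
      Finset.sum_congr rfl fun y _ => by rw [mul_add, mul_add])
  simp only [Finset.sum_add_distrib] at hsplit
  rw [hsplit, hM] at hpt
  rw [hL]
  simp only [mul_add, Finset.sum_add_distrib] at hE hpt ⊢
  linarith

end
end

section
/- Label-dependent lower bound for federated SimCLR (semi-supervised, discrete version): Let S and Y be random variables on finite types with joint pmf p(s, y), and for each pair (s, y) let p(z1, z2 | y, s) be a joint pmf of (Z1, Z2) on a finite type Z × Z. Let f : Z × Z → ℝ be a critic function, K ≥ 1 a natural number, r_S(s | z) a conditional pmf over the values of S, and r_Y(y | z) a conditional pmf over the values of Y, each strictly positive on every value pair of positive joint probability with Z1 or Z2. Then I(Z1; Z2) ≥ ∑_{s,y} p(s, y) · ( E[ (1/K) ∑_{k=1}^{K} ( log( exp(f(z1_k, z2_k)) / ( (1/K) ∑_{j=1}^{K} exp(f(z1_j, z2_k)) ) ) + log r_S(s | z1_k) + log r_S(s | z2_k) + log r_Y(y | z1_k) + log r_Y(y | z2_k) ) ] + H(Y | S=s) ) + H(S), where the expectation is over K pairs (z1_k, z2_k) drawn i.i.d. from p(z1, z2 | y, s), and H(Y | S=s) := −∑_y P(Y=y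 | S=s) · log P(Y=y | S=s). -/
/-!
Label-dependent lower bound for federated SimCLR (semi-supervised, discrete
version): with `(S, Y) ~ pSY` and `(Z1, Z2) | (Y = y, S = s) ~ pC s y`
(joint pmf `p s y z1 z2 = pSY s y * pC s y z1 z2`), for any critic `f`,
any `K ≥ 1`, any client classifier `rS (s | z)` and label classifier
`rY (y | z)`, each positive on every value pair of positive joint probability
with Z1 or Z2,
I(Z1; Z2) ≥ ∑_{s,y} p(s,y) · ( E[ (1/K) ∑_k ( InfoNCE term
  + log rS(s|z1_k) + log rS(s|z2_k) + log rY(y|z1_k) + log rY(y|z2_k) ) ]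
  + H(Y | S = s) ) + H(S).
-/

open Finset

noncomputable section

variable {S Y Z : Type*} [Fintype S] [Fintype Y] [Fintype Z]

/-- Marginal P(Z1 = z1). -/
def margZ1 (p : S → Y → Z → Z → ℝ) (z1 : Z) : ℝ := ∑ s, ∑ y, ∑ z2, p s y z1 z2

/-- Marginal P(Z2 = z2). -/
def margZ2 (p : S → Y → Z → Z → ℝ) (z2 : Z) : ℝ := ∑ s, ∑ y, ∑ z1, p s y z1 z2

/-- Marginal P(Z1 = z1, Z2 = z2). -/
def margZ1Z2 (p : S → Y → Z → Z → ℝ) (z1 z2 : Z) : ℝ := ∑ s, ∑ y, p s y z1 z2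

/-- Mutual information I(Z1; Z2), with terms of zero joint probability
contributing 0. -/
def miZ1Z2 (p : S → Y → Z → Z → ℝ) : ℝ :=
  ∑ z1, ∑ z2, margZ1Z2 p z1 z2 *
    Real.log (margZ1Z2 p z1 z2 / (margZ1 p z1 * margZ2 p z2))

/-- Entropy H(S) of the S-marginal of the pmf of (S, Y). -/
def entS (pSY : S → Y → ℝ) : ℝ :=
  -∑ s, (∑ y, pSY s y) * Real.log (∑ y, pSY s y)

/-- Mutual information of a joint pmf on a product of two copies of a type. -/
def pairMI (m : Z → Z → ℝ) : ℝ :=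
  ∑ z1, ∑ z2, m z1 z2 * Real.log (m z1 z2 / ((∑ t, m z1 t) * ∑ t, m t z2))

lemma sum_apply_mul_prod_erase {ι α : Type*} [Fintype ι] [DecidableEq ι] [Fintype α]
    (k : ι) (h : α → ℝ) (F : ι → α → ℝ) :
    ∑ v : ι → α, h (v k) * ∏ j ∈ univ.erase k, F j (v j) =
      (∑ w, h w) * ∏ j ∈ univ.erase k, ∑ w, F j w := by
  have key := Fintype.prod_sum (fun j w => if j = k then h w else F j w)
  rw [← mul_prod_erase univ _ (mem_univ k)] at key
  simp only [if_true] at key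
  have h1 : ∀ j ∈ univ.erase k,
      (∑ w, if j = k then h w else F j w) = ∑ w, F j w := fun j hj => by
    simp [ne_of_mem_erase hj]
  rw [prod_congr rfl h1] at key
  rw [key]
  refine sum_congr rfl fun v _ => ?_
  rw [← mul_prod_erase univ (fun j => if j = k then h (v j) else F j (v j)) (mem_univ k)]
  simp only [if_true]
  congr 1
  exact prod_congr rfl fun j hj => by simp [ne_of_mem_erase hj]

lemma sum_prod_mul_apply_s15 {ι α : Type*} [Fintype ι] [DecidableEq ι] [Fintype α]
    (k : ι) (P : α → ℝ) (hP : ∑ w, P w = 1) (h : α → ℝ) :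
    ∑ v : ι → α, (∏ j, P (v j)) * h (v k) = ∑ w, P w * h w := by
  have key := sum_apply_mul_prod_erase k (fun w => P w * h w) (fun _ => P)
  simp only [hP, prod_const_one, mul_one] at key
  rw [← key]
  refine sum_congr rfl fun v _ => ?_
  rw [← mul_prod_erase univ (fun j => P (v j)) (mem_univ k)]
  ring

lemma mul_log_sub_log_div_le {m q g : ℝ} (hm : 0 ≤ m) (hq : 0 ≤ q) (hmq : 0 < m → 0 < q)
    (hg : 0 < g) : m * (Real.log g - Real.log (m / q)) ≤ q * g - m := by
  rcases hm.eq_or_lt with rfl | hm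
  · simpa using mul_nonneg hq hg.le
  · have hq := hmq hm
    rw [← Real.log_div hg.ne' (by positivity)]
    calc m * Real.log (g / (m / q)) ≤ m * (g / (m / q) - 1) :=
          mul_le_mul_of_nonneg_left (Real.log_le_sub_one_of_pos (by positivity)) hm.le
      _ = q * g - m := by field_simp

/-- Summing a softmax-type ratio over independent first coordinates and a decoupled `k`-th second
coordinate. -/
lemma sum_decoupled (m : Z → Z → ℝ) {K : ℕ} (b : Z → ℝ) (k : Fin K)
    (g : (Fin K → Z) → Z → ℝ) :
    ∑ v : Fin K → Z × Z, ((∑ t, m (v k).1 t) * b (v k).2 *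
        ∏ j ∈ univ.erase k, m (v j).1 (v j).2) * g (fun j => (v j).1) (v k).2 =
      ∑ x : Fin K → Z, (∏ j, ∑ t, m (x j) t) * ∑ t, b t * g x t := by
  rw [← (Equiv.arrowProdEquivProdArrow (Fin K) (fun _ => Z) (fun _ => Z)).symm.sum_comp,
    Fintype.sum_prod_type]
  refine sum_congr rfl fun x _ => ?_
  have key := sum_apply_mul_prod_erase k (fun t => b t * g x t) (fun j t => m (x j) t)
  rw [← mul_prod_erase univ (fun j => ∑ t, m (x j) t) (mem_univ k), mul_assoc,
    mul_comm (∏ j ∈ _, _), ← key, mul_sum]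
  refine sum_congr rfl fun y _ => ?_
  simp only [Equiv.arrowProdEquivProdArrow, Equiv.coe_fn_symm_mk]
  ring

/-- The InfoNCE bound, with an additive reward `c`. -/
lemma infoNCE_le (m : Z → Z → ℝ) (hm : ∀ z1 z2, 0 ≤ m z1 z2)
    (hs : ∑ z1, ∑ z2, m z1 z2 = 1) (K : ℕ) (hK : 1 ≤ K) (f c : Z → Z → ℝ) :
    ∑ v : Fin K → Z × Z, (∏ k, m (v k).1 (v k).2) *
      ((1 / (K : ℝ)) * ∑ k : Fin K,
        (Real.log (Real.exp (f (v k).1 (v k).2) /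
          ((1 / (K : ℝ)) * ∑ j : Fin K, Real.exp (f (v j).1 (v k).2))) + c (v k).1 (v k).2)) ≤
      pairMI m + ∑ z1, ∑ z2, m z1 z2 * c z1 z2 := by
  have hK0 : (0 : ℝ) < K := by exact_mod_cast hK
  have : Nonempty (Fin K) := ⟨⟨0, hK⟩⟩
  set a : Z → ℝ := fun z => ∑ t, m z t with ha
  set b : Z → ℝ := fun z => ∑ t, m t z with hb
  have ha0 : ∀ z, 0 ≤ a z := fun z => sum_nonneg fun t _ => hm z t
  have hb0 : ∀ z, 0 ≤ b z := fun z => sum_nonneg fun t _ => hm t z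
  have hpos : ∀ x y, 0 < m x y → 0 < a x * b y := fun x y h =>
    mul_pos (h.trans_le (single_le_sum (f := fun t => m x t) (fun t _ => hm x t) (mem_univ y)))
      (h.trans_le (single_le_sum (f := fun t => m t y) (fun t _ => hm t y) (mem_univ x)))
  set g : Fin K → (Fin K → Z) → Z → ℝ := fun k x t =>
    Real.exp (f (x k) t) / ((1 / (K : ℝ)) * ∑ j : Fin K, Real.exp (f (x j) t)) with hg
  have hden : ∀ (x : Fin K → Z) t, 0 < ∑ j : Fin K, Real.exp (f (x j) t) := fun x t =>
    sum_pos (fun _ _ => Real.exp_pos _) univ_nonempty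
  have hgpos : ∀ k x t, 0 < g k x t := fun k x t =>
    div_pos (Real.exp_pos _) (mul_pos (by positivity) (hden x t))
  have hgsum : ∀ x t, ∑ k, g k x t = K := fun x t => by
    have := (hden x t).ne'
    rw [hg, ← sum_div]
    field_simp
  set d : Z × Z → ℝ := fun w => Real.log (m w.1 w.2 / (a w.1 * b w.2)) + c w.1 w.2 with hd
  set P : (Fin K → Z × Z) → ℝ := fun v => ∏ k, m (v k).1 (v k).2 with hP
  set Q : Fin K → (Fin K → Z × Z) → ℝ := fun k v =>
    a (v k).1 * b (v k).2 * ∏ j ∈ univ.erase k, m (v j).1 (v j).2 with hQ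
  have hpt : ∀ v k, P v * (Real.log (g k (fun j => (v j).1) (v k).2) + c (v k).1 (v k).2) ≤
      P v * d (v k) + (Q k v * g k (fun j => (v j).1) (v k).2 - P v) := by
    intro v k
    have hR : 0 ≤ ∏ j ∈ univ.erase k, m (v j).1 (v j).2 := prod_nonneg fun j _ => hm _ _
    have hPv : P v = m (v k).1 (v k).2 * ∏ j ∈ univ.erase k, m (v j).1 (v j).2 :=
      (mul_prod_erase univ (fun j => m (v j).1 (v j).2) (mem_univ k)).symm
    have := mul_le_mul_of_nonneg_right (mul_log_sub_log_div_le (hm (v k).1 (v k).2)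
      (mul_nonneg (ha0 (v k).1) (hb0 (v k).2)) (hpos _ _)
      (hgpos k (fun j => (v j).1) (v k).2)) hR
    simp only [hPv, hQ, hd]
    linarith
  have hs' : ∑ w : Z × Z, m w.1 w.2 = 1 := by rw [Fintype.sum_prod_type]; exact hs
  have hPd : ∀ k, ∑ v, P v * d (v k) = pairMI m + ∑ z1, ∑ z2, m z1 z2 * c z1 z2 := by
    intro k
    rw [hP, sum_prod_mul_apply_s15 k (fun w : Z × Z => m w.1 w.2) hs' d, Fintype.sum_prod_type,
      pairMI, ← sum_add_distrib]
    refine sum_congr rfl fun x _ => ?_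
    rw [← sum_add_distrib]
    exact sum_congr rfl fun y _ => mul_add _ _ _
  have hP1 : ∑ v, P v = 1 := by
    have := sum_prod_mul_apply_s15 (⟨0, hK⟩ : Fin K) (fun w : Z × Z => m w.1 w.2) hs' (fun _ => 1)
    simpa [hP, hs'] using this
  have ha1 : ∑ x : Fin K → Z, ∏ j, a (x j) = 1 := by
    have := sum_prod_mul_apply_s15 (⟨0, hK⟩ : Fin K) a hs (fun _ => 1)
    simp only [mul_one] at this
    rw [this]
    exact hs
  have hb1 : ∑ t, b t = 1 := by rw [hb, sum_comm]; exact hs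
  have hQg : ∑ k, ∑ v, Q k v * g k (fun j => (v j).1) (v k).2 = K := by
    simp only [hQ, ha, sum_decoupled m b]
    rw [sum_comm]
    simp only [← mul_sum]
    have : ∀ x : Fin K → Z, ∑ k, ∑ t, b t * g k x t = K := fun x => by
      rw [sum_comm]
      simp only [← mul_sum, hgsum]
      rw [← sum_mul, hb1, one_mul]
    simp only [this]
    rw [← sum_mul]
    exact (congrArg (· * (K : ℝ)) ha1).trans (one_mul _)
  calc _ = (1 / (K : ℝ)) * ∑ k : Fin K, ∑ v,
        P v * (Real.log (g k (fun j => (v j).1) (v k).2) + c (v k).1 (v k).2) := by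
        rw [sum_comm, mul_sum]
        refine sum_congr rfl fun v _ => ?_
        rw [← mul_sum]
        ring
    _ ≤ (1 / (K : ℝ)) * ∑ k : Fin K, ∑ v,
        (P v * d (v k) + (Q k v * g k (fun j => (v j).1) (v k).2 - P v)) := by
        gcongr with k _ v _
        exact hpt v k
    _ = _ := by
        simp only [sum_add_distrib, sum_sub_distrib, hPd, hQg, hP1, sum_const, card_univ,
          Fintype.card_fin, nsmul_eq_mul]
        field_simp
        ring

lemma sum_variational_defect_le_one {W : Type*} [Fintype W] (m : W → Z → Z → ℝ)
    (r : Z → ℝ) (hr : ∀ z, 0 ≤ r z) (hr1 : ∑ z, r z = 1)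
    (q : Z → W → ℝ) (hq : ∀ z w, 0 ≤ q z w) (hq1 : ∀ z, ∑ w, q z w = 1) :
    ∑ w, ∑ z1, ∑ z2, m w z1 z2 / (∑ t, m w z1 t) * (r z1 * q z1 w) ≤ 1 := by
  calc _ ≤ ∑ w, ∑ z1, r z1 * q z1 w := by
        refine sum_le_sum fun w _ => sum_le_sum fun z1 _ => ?_
        rw [← sum_mul, ← sum_div]
        exact mul_le_of_le_one_left (mul_nonneg (hr _) (hq _ _)) (div_self_le_one _)
    _ = 1 := by
        rw [sum_comm]
        simp only [← mul_sum, hq1, mul_one, hr1]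

/-- Lower bound on the mutual information of a mixture `∑ w, p w * m w` by the conditional
mutual information, the entropy of `p`, and a classifier `q` applied to both coordinates. -/
lemma pairMI_mixture_ge {W : Type*} [Fintype W] (p : W → ℝ) (m : W → Z → Z → ℝ)
    (hp : ∀ w, 0 ≤ p w) (hp1 : ∑ w, p w = 1) (hm : ∀ w z1 z2, 0 ≤ m w z1 z2)
    (hm1 : ∀ w, ∑ z1, ∑ z2, m w z1 z2 = 1)
    (q : Z → W → ℝ) (hq : ∀ z w, 0 ≤ q z w) (hq1 : ∀ z, ∑ w, q z w = 1)
    (hqpos : ∀ w z1 z2, 0 < p w * m w z1 z2 → 0 < q z1 w ∧ 0 < q z2 w) :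
    ∑ w, p w * (pairMI (m w) +
        ∑ z1, ∑ z2, m w z1 z2 * (Real.log (q z1 w) + Real.log (q z2 w))) -
      ∑ w, p w * Real.log (p w) ≤ pairMI (fun z1 z2 => ∑ w, p w * m w z1 z2) := by
  set J : Z → Z → ℝ := fun z1 z2 => ∑ w, p w * m w z1 z2 with hJ
  set A : Z → ℝ := fun z => ∑ t, J z t with hA
  set B : Z → ℝ := fun z => ∑ t, J t z with hB
  set a : W → Z → ℝ := fun w z => ∑ t, m w z t with ha
  set b : W → Z → ℝ := fun w z => ∑ t, m w t z with hb
  have hpm : ∀ w z1 z2, 0 ≤ p w * m w z1 z2 := fun w z1 z2 => mul_nonneg (hp w) (hm w z1 z2)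
  have hJ0 : ∀ x y, 0 ≤ J x y := fun x y => sum_nonneg fun w _ => hpm w x y
  have hA0 : ∀ x, 0 ≤ A x := fun x => sum_nonneg fun y _ => hJ0 x y
  have hB0 : ∀ x, 0 ≤ B x := fun x => sum_nonneg fun y _ => hJ0 y x
  have hA1 : ∑ x, A x = 1 := by
    simp only [hA, hJ]
    rw [sum_congr rfl fun x _ => sum_comm, sum_comm]
    simp only [← mul_sum, hm1, mul_one, hp1]
  have hB1 : ∑ x, B x = 1 := by rw [hB, sum_comm]; exact hA1
  have hpt : ∀ w x y,
      p w * m w x y * (Real.log (m w x y / (a w x * b w y)) +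
        (Real.log (q x w) + Real.log (q y w)) - Real.log (p w)) +
      ((p w * m w x y - m w x y / a w x * (A x * q x w)) +
       (p w * m w x y - m w x y / b w y * (B y * q y w))) ≤
      p w * m w x y * Real.log (J x y / (A x * B y)) := by
    intro w x y
    have hax : 0 ≤ a w x := sum_nonneg fun t _ => hm _ _ _
    have hby : 0 ≤ b w y := sum_nonneg fun t _ => hm _ _ _
    rcases (hpm w x y).eq_or_lt with h0 | h0
    · rw [← h0]
      have h1 := mul_nonneg (div_nonneg (hm w x y) hax) (mul_nonneg (hA0 x) (hq x w))
      have h2 := mul_nonneg (div_nonneg (hm w x y) hby) (mul_nonneg (hB0 y) (hq y w))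
      linarith
    · obtain ⟨hqx, hqy⟩ := hqpos w x y h0
      have hpw : 0 < p w := pos_of_mul_pos_left h0 (hm w x y)
      have hmw : 0 < m w x y := pos_of_mul_pos_right h0 (hp w)
      have hax : 0 < a w x :=
        hmw.trans_le (single_le_sum (f := fun t => m w x t) (fun t _ => hm w x t) (mem_univ y))
      have hby : 0 < b w y :=
        hmw.trans_le (single_le_sum (f := fun t => m w t y) (fun t _ => hm w t y) (mem_univ x))
      have hJle : p w * m w x y ≤ J x y :=
        single_le_sum (f := fun w => p w * m w x y) (fun w _ => hpm w x y) (mem_univ w)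
      have hJp : 0 < J x y := h0.trans_le hJle
      have hAp : 0 < A x :=
        hJp.trans_le (single_le_sum (f := fun t => J x t) (fun t _ => hJ0 x t) (mem_univ y))
      have hBp : 0 < B y :=
        hJp.trans_le (single_le_sum (f := fun t => J t y) (fun t _ => hJ0 t y) (mem_univ x))
      have e1 := Real.log_le_log h0 hJle
      have e2 := Real.log_le_sub_one_of_pos (x := A x * q x w / (p w * a w x)) (by positivity)
      have e3 := Real.log_le_sub_one_of_pos (x := B y * q y w / (p w * b w y)) (by positivity)
      rw [Real.log_mul (by positivity) (by positivity)] at e1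
      rw [Real.log_div (by positivity) (by positivity), Real.log_mul (by positivity) (by positivity),
        Real.log_mul (by positivity) (by positivity)] at e2 e3
      rw [Real.log_div (by positivity) (by positivity), Real.log_div (by positivity) (by positivity),
        Real.log_mul (by positivity) (by positivity), Real.log_mul (by positivity) (by positivity)]
      have i1 : m w x y / a w x * (A x * q x w) =
          p w * m w x y * (A x * q x w / (p w * a w x)) := by field_simp
      have i2 : m w x y / b w y * (B y * q y w) =
          p w * m w x y * (B y * q y w / (p w * b w y)) := by field_simp
      rw [i1, i2]
      have := mul_le_mul_of_nonneg_left (add_le_add e1 (add_le_add e2 e3)) h0.le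
      linarith
  have hd1 := sum_variational_defect_le_one m A hA0 hA1 q hq hq1
  have hd2 := sum_variational_defect_le_one (fun w x y => m w y x) B hB0 hB1 q hq hq1
  rw [sum_congr rfl fun w _ => sum_comm] at hd2
  have hsum := sum_le_sum fun w (_ : w ∈ univ) => sum_le_sum fun x (_ : x ∈ univ) =>
    sum_le_sum fun y (_ : y ∈ univ) => hpt w x y
  simp only [sum_add_distrib, sum_sub_distrib] at hsum
  have hpm1 : ∑ w, ∑ x, ∑ y, p w * m w x y = 1 := by
    simp only [← mul_sum, hm1, mul_one, hp1]
  have hR : ∑ w, ∑ x, ∑ y, p w * m w x y * Real.log (J x y / (A x * B y)) = pairMI J := by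
    rw [sum_comm, pairMI]
    refine sum_congr rfl fun x _ => ?_
    rw [sum_comm]
    exact sum_congr rfl fun y _ => (sum_mul _ _ _).symm
  have hL : ∑ w, ∑ x, ∑ y, p w * m w x y * (Real.log (m w x y / (a w x * b w y)) +
        (Real.log (q x w) + Real.log (q y w)) - Real.log (p w)) =
      ∑ w, p w * (pairMI (m w) +
        ∑ z1, ∑ z2, m w z1 z2 * (Real.log (q z1 w) + Real.log (q z2 w))) -
      ∑ w, p w * Real.log (p w) := by
    rw [← sum_sub_distrib]
    refine sum_congr rfl fun w _ => ?_
    have : p w * Real.log (p w) = ∑ x, ∑ y, p w * Real.log (p w) * m w x y := by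
      simp only [← mul_sum, hm1, mul_one]
    rw [this, pairMI, mul_add, mul_sum, mul_sum, ← sum_add_distrib, ← sum_sub_distrib]
    refine sum_congr rfl fun x _ => ?_
    rw [mul_sum, mul_sum, ← sum_add_distrib, ← sum_sub_distrib]
    exact sum_congr rfl fun y _ => by ring
  rw [hR, hpm1] at hsum
  linarith

/-- Chain rule for the entropy of the pair `(S, Y)`. -/
lemma sum_mul_entY_at_add_entS (pSY : S → Y → ℝ) (h : ∀ s y, 0 ≤ pSY s y) :
    ∑ s, ∑ y, pSY s y * entY_at pSY s + entS pSY =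
      -∑ s, ∑ y, pSY s y * Real.log (pSY s y) := by
  rw [entS, ← sum_neg_distrib, ← sum_neg_distrib, ← sum_add_distrib]
  refine sum_congr rfl fun s _ => ?_
  rw [← sum_mul, entY_at, mul_neg, mul_sum, ← neg_add, sum_mul, ← sum_add_distrib]
  congr 1
  refine sum_congr rfl fun y _ => ?_
  rcases (h s y).eq_or_lt with h0 | h0
  · simp [← h0]
  · have hs : 0 < ∑ y', pSY s y' :=
      h0.trans_le (single_le_sum (fun t _ => h s t) (mem_univ y))
    rw [Real.log_div h0.ne' hs.ne']
    field_simp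
    ring

lemma miZ1Z2_eq_pairMI (p : S → Y → Z → Z → ℝ) :
    miZ1Z2 p = pairMI (fun z1 z2 => ∑ w : S × Y, p w.1 w.2 z1 z2) := by
  have h : ∀ F : S → Y → Z → ℝ, ∑ s, ∑ y, ∑ z, F s y z = ∑ z, ∑ s, ∑ y, F s y z := fun F => by
    rw [sum_congr rfl fun s _ => sum_comm, sum_comm]
  simp only [miZ1Z2, pairMI, margZ1, margZ2, margZ1Z2, Fintype.sum_prod_type, h]

lemma sum_sum_pos {α β : Type*} [Fintype α] [Fintype β] {F : α → β → ℝ}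
    (hF : ∀ x y, 0 ≤ F x y) {x : α} {y : β} (hxy : 0 < F x y) : 0 < ∑ x, ∑ y, F x y :=
  sum_pos' (fun x _ => sum_nonneg fun y _ => hF x y)
    ⟨x, mem_univ x, sum_pos' (fun y _ => hF x y) ⟨y, mem_univ y, hxy⟩⟩

/-- Label-dependent lower bound for federated SimCLR. -/
theorem label_dependent_federated_simclr_bound
    (pSY : S → Y → ℝ) (pC : S → Y → Z → Z → ℝ)
    (hpSY_nonneg : ∀ s y, 0 ≤ pSY s y) (hpSY_sum : ∑ s, ∑ y, pSY s y = 1)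
    (hpC_nonneg : ∀ s y z1 z2, 0 ≤ pC s y z1 z2)
    (hpC_sum : ∀ s y, ∑ z1, ∑ z2, pC s y z1 z2 = 1)
    (K : ℕ) (hK : 1 ≤ K) (f : Z → Z → ℝ)
    (rS : Z → S → ℝ) (rY : Z → Y → ℝ)
    (hrS_nonneg : ∀ z s, 0 ≤ rS z s)
    (hrS_sum : ∀ z, ∑ s, rS z s = 1)
    (hrS_pos : ∀ s z,
      0 < margSZ1 (joint pSY pC) s z ∨ 0 < margSZ2 (joint pSY pC) s z →
      0 < rS z s)
    (hrY_nonneg : ∀ z y, 0 ≤ rY z y)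
    (hrY_sum : ∀ z, ∑ y, rY z y = 1)
    (hrY_pos : ∀ y z,
      0 < margYZ1 (joint pSY pC) y z ∨ 0 < margYZ2 (joint pSY pC) y z →
      0 < rY z y) :
    miZ1Z2 (joint pSY pC) ≥
      (∑ s, ∑ y, pSY s y *
        ((∑ v : Fin K → Z × Z, (∏ k, pC s y (v k).1 (v k).2) *
          ((1 / (K : ℝ)) * ∑ k : Fin K,
            (Real.log (Real.exp (f (v k).1 (v k).2) /
                ((1 / (K : ℝ)) * ∑ j : Fin K, Real.exp (f (v j).1 (v k).2)))
              + Real.log (rS (v k).1 s) + Real.log (rS (v k).2 s)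
              + Real.log (rY (v k).1 y) + Real.log (rY (v k).2 y)))) +
          entY_at pSY s)) + entS pSY := by
  have hpos : ∀ s y z1 z2, 0 < pSY s y * pC s y z1 z2 →
      (0 < rS z1 s ∧ 0 < rS z2 s) ∧ 0 < rY z1 y ∧ 0 < rY z2 y := by
    intro s y z1 z2 h
    have hj : ∀ s y z1 z2, 0 ≤ joint pSY pC s y z1 z2 := fun s y z1 z2 =>
      mul_nonneg (hpSY_nonneg s y) (hpC_nonneg s y z1 z2)
    have hj0 : 0 < joint pSY pC s y z1 z2 := h
    have hSZ1 : 0 < margSZ1 (joint pSY pC) s z1 :=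
      sum_sum_pos (fun y z2 => hj s y z1 z2) hj0
    have hSZ2 : 0 < margSZ2 (joint pSY pC) s z2 :=
      sum_sum_pos (fun y z1 => hj s y z1 z2) hj0
    have hYZ1 : 0 < margYZ1 (joint pSY pC) y z1 :=
      sum_sum_pos (fun s z2 => hj s y z1 z2) hj0
    have hYZ2 : 0 < margYZ2 (joint pSY pC) y z2 :=
      sum_sum_pos (fun s z1 => hj s y z1 z2) hj0
    exact ⟨⟨hrS_pos s z1 (Or.inl hSZ1), hrS_pos s z2 (Or.inr hSZ2)⟩,
      hrY_pos y z1 (Or.inl hYZ1), hrY_pos y z2 (Or.inr hYZ2)⟩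
  have hmix := pairMI_mixture_ge (fun w : S × Y => pSY w.1 w.2) (fun w => pC w.1 w.2)
    (fun w => hpSY_nonneg _ _) (by rw [Fintype.sum_prod_type]; exact hpSY_sum)
    (fun w => hpC_nonneg _ _) (fun w => hpC_sum _ _) (fun z w => rS z w.1 * rY z w.2)
    (fun z w => mul_nonneg (hrS_nonneg _ _) (hrY_nonneg _ _))
    (fun z => by
      rw [Fintype.sum_prod_type]
      simp only [← mul_sum, hrY_sum, mul_one, hrS_sum])
    (fun w z1 z2 h =>
      have h' := hpos _ _ _ _ h
      ⟨mul_pos h'.1.1 h'.2.1, mul_pos h'.1.2 h'.2.2⟩)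
  rw [miZ1Z2_eq_pairMI]
  refine ge_iff_le.2 (le_trans ?_ hmix)
  rw [Fintype.sum_prod_type, Fintype.sum_prod_type, sub_eq_add_neg,
    ← sum_mul_entY_at_add_entS pSY hpSY_nonneg, ← add_assoc, ← sum_add_distrib]
  gcongr with s _
  rw [← sum_add_distrib]
  gcongr with y _
  rw [mul_add]
  gcongr ?_ + _
  rcases (hpSY_nonneg s y).eq_or_lt with h0 | h0
  · simp [← h0]
  gcongr ?_ * ?_
  have hnce := infoNCE_le (pC s y) (hpC_nonneg s y) (hpC_sum s y) K hK f
    (fun z1 z2 => Real.log (rS z1 s) + (Real.log (rS z2 s) +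
      (Real.log (rY z1 y) + Real.log (rY z2 y))))
  simp only [add_assoc]
  refine hnce.trans (le_of_eq ?_)
  congr 1
  refine sum_congr rfl fun z1 _ => sum_congr rfl fun z2 _ => ?_
  rcases (hpC_nonneg s y z1 z2).eq_or_lt with h1 | h1
  · simp [← h1]
  obtain ⟨⟨h2, h3⟩, h4, h5⟩ := hpos s y z1 z2 (mul_pos h0 h1)
  rw [Real.log_mul h2.ne' h4.ne', Real.log_mul h3.ne' h5.ne']
  ring

end
end
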